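/- Let R be a commutative ring, H a Hopf R-algebra with antipode S, and D an R-coalgebra with a right H-module structure making it a right H-module coalgebra. Let ω : D → H be an H-linear map (ω(d·h) = ω(d)h) which is invertible in the convolution algebra Hom_R(D,H) with convolution inverse ω^{-1}. Then ω^{-1}(d·h) = S(h)·ω^{-1}(d) for all d ∈ D and h ∈ H. -/

import Mathlib

open TensorProduct

/-- The convolution product on `Hom_R(D,H)`:
`(f ⋆ g)(d) = Σ f(d_1) g(d_2)`. -/
noncomputable def convHom (R D H : Type*) [CommRing R]
    [AddCommGroup D] [Module R D] [Coalgebra R D] [Ring H] [Algebra R H]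
    (f g : D →ₗ[R] H) : D →ₗ[R] H :=
  LinearMap.mul' R H ∘ₗ TensorProduct.map f g ∘ₗ Coalgebra.comul

/-- Let `H` be a Hopf `R`-algebra with antipode `S` and `D` a right
`H`-module coalgebra.  If `ω : D → H` is `H`-linear and convolution invertible with
convolution inverse `ω'`, then `ω'(d·h) = S(h) ω'(d)` for all `d ∈ D`, `h ∈ H`. -/
theorem conv_inverse_of_H_linear
    {R H D : Type*} [CommRing R] [Ring H] [HopfAlgebra R H]
    [AddCommGroup D] [Module R D] [Coalgebra R D]
    -- `D` is a right `H`-module: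
    (act : D →ₗ[R] H →ₗ[R] D)
    (hact_mul : ∀ (d : D) (h k : H), act (act d h) k = act d (h * k))
    (hact_one : ∀ d : D, act d 1 = d)
    -- which is a right `H`-module coalgebra:
    (hΔ : ∀ (d : D) (h : H),
        Coalgebra.comul (act d h)
          = TensorProduct.map (TensorProduct.lift act) (TensorProduct.lift act)
              (TensorProduct.tensorTensorTensorComm R D D H H
                (Coalgebra.comul d ⊗ₜ[R] Coalgebra.comul h)))
    (hε : ∀ (d : D) (h : H),
        Coalgebra.counit (act d h) = Coalgebra.counit (R := R) d * Coalgebra.counit (R := R) h)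
    -- `ω` is `H`-linear:
    (ω : D →ₗ[R] H) (hω : ∀ (d : D) (h : H), ω (act d h) = ω d * h)
    -- with convolution inverse `ω'`:
    (ω' : D →ₗ[R] H)
    (hinv₁ : convHom R D H ω ω' = Algebra.linearMap R H ∘ₗ Coalgebra.counit)
    (hinv₂ : convHom R D H ω' ω = Algebra.linearMap R H ∘ₗ Coalgebra.counit) :
    ∀ (d : D) (h : H), ω' (act d h) = HopfAlgebra.antipode (R := R) h * ω' d := by
  let μ : D ⊗[R] H →ₗc[R] D :=
    { TensorProduct.lift act with
      counit_comp := by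
        ext d h
        simp [hε, mul_comm]
      map_comp_comul := by
        ext d h
        simp [hΔ, AlgebraTensorModule.tensorTensorTensorComm_eq] }
  let τ : WithConv (D ⊗[R] H →ₗ[R] H) := WithConv.toConv
    (TensorProduct.lift
      ((LinearMap.mul R H).flip.compl₁₂ ω' (HopfAlgebra.antipode R)))
  have hleft : WithConv.toConv (ω' ∘ₗ μ.toLinearMap) * WithConv.toConv (ω ∘ₗ μ.toLinearMap) = 1 := by
    have hinv : WithConv.toConv ω' * WithConv.toConv ω = 1 := congrArg WithConv.toConv hinv₂
    have hcomp := LinearMap.convMul_comp_coalgHom_distrib (WithConv.toConv ω') (WithConv.toConv ω) μ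
    rw [hinv] at hcomp
    apply WithConv.ofConv_injective
    rw [← hcomp]
    ext d h
    simp [μ, hε, mul_comm]
  have hright : WithConv.toConv (ω ∘ₗ μ.toLinearMap) * τ = 1 := by
    apply WithConv.ofConv_injective
    ext d h
    let rd := Coalgebra.Repr.arbitrary R d
    let rh := Coalgebra.Repr.arbitrary R h
    have hd : ∑ i ∈ rd.index, ω (rd.left i) * ω' (rd.right i) =
        algebraMap R H (Coalgebra.counit d) := by
      have := LinearMap.congr_fun hinv₁ d
      simpa [convHom, ← rd.eq] using this
    have hh (a b : H) :
        ∑ j ∈ rh.index, a * rh.left j * (HopfAlgebra.antipode R (rh.right j) * b) =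
          Coalgebra.counit (R := R) h • (a * b) := by
      simp_rw [mul_assoc a, ← Finset.mul_sum, ← mul_assoc _ _ b, ← Finset.sum_mul,
        HopfAlgebra.sum_mul_antipode_eq_smul rh, smul_mul_assoc, one_mul, mul_smul_comm]
    calc
      _ = ∑ i ∈ rd.index, ∑ j ∈ rh.index, ω (rd.left i) * rh.left j *
            (HopfAlgebra.antipode R (rh.right j) * ω' (rd.right i)) := by
        simp [τ, μ, hω, ← rd.eq, ← rh.eq, TensorProduct.sum_tmul, TensorProduct.tmul_sum]
        exact Finset.sum_comm
      _ = _ := by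
        simp_rw [hh, ← Finset.smul_sum, hd]
        simp [Algebra.smul_def]
  intro d h
  exact LinearMap.congr_fun (congrArg WithConv.ofConv (left_inv_eq_right_inv hleft hright)) (d ⊗ₜ h)
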